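/- Let I and J be set supercompositions. Then Q_I · Q_J = Σ_{K ∈ SSh(I,J)} sgn(K) · Q_K, the sum running over all (I,J)-super-shuffles K with their signs. -/

import Mathlib

/-- A noncommutative superspace monomial: `S` records the θ-indices (taken in increasing
order) and `w` is the word of `x`-indices. -/
structure NCMon where
  S : Finset ℕ
  w : List ℕ
deriving DecidableEq

namespace NCMon

/-- The set of indices of a noncommutative superspace monomial. -/
def ind (u : NCMon) : Finset ℕ := u.S ∪ u.w.toFinset

/-- The total degree of a noncommutative superspace monomial. -/
def deg (u : NCMon) : ℕ := u.S.card + u.w.length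

end NCMon

/-- The rank of `a` in the finite set `A`: the number of elements of `A` that are `≤ a`. -/
def rk (A : Finset ℕ) (a : ℕ) : ℕ := (A.filter (· ≤ a)).card

/-- Standardization of a monomial: relabel its indices via the unique order-preserving
bijection `ind u → {1, …, k}`. -/
def NCMon.std (u : NCMon) : NCMon := ⟨u.S.image (rk u.ind), u.w.map (rk u.ind)⟩

/-- The set supercomposition `I(u)` associated with a monomial `u`: its `r`-th block
records the (1-indexed) positions of the `r`-th smallest index in the word, together
with `0` whenever that index is a θ-index. -/
def NCMon.scomp (u : NCMon) : List (Finset ℕ) :=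
  (List.range u.ind.card).map fun r₀ =>
    (((Finset.range u.w.length).filter fun t => rk u.ind (u.w.getD t 0) = r₀ + 1).image (· + 1))
      ∪ (if r₀ + 1 ∈ u.S.image (rk u.ind) then ({0} : Finset ℕ) else ∅)

/-- The monomial quasisymmetric function in noncommuting variables in superspace:
the indicator function of the monomials whose set supercomposition is `I`. -/
def Mfn (I : List (Finset ℕ)) : NCMon → ℚ := fun u => if u.scomp = I then 1 else 0

/-- Number of inversions between two θ-supports. -/
def invST (S T : Finset ℕ) : ℕ := ((S ×ˢ T).filter fun p => p.2 < p.1).card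

/-- The product of coefficient functions, induced by the signed monomial product
`(S,w)·(T,v) = 0` if `S ∩ T ≠ ∅` and `(-1)^{inv(S,T)} (S ∪ T, w·v)` otherwise. -/
def mulF (f g : NCMon → ℚ) : NCMon → ℚ := fun m =>
  ∑ k ∈ Finset.range (m.w.length + 1), ∑ S₁ ∈ m.S.powerset,
    (-1 : ℚ) ^ invST S₁ (m.S \ S₁) * f ⟨S₁, m.w.take k⟩ * g ⟨m.S \ S₁, m.w.drop k⟩

/-- Quasisymmetry in noncommuting variables in superspace: the coefficient of a monomial
depends only on its standardization. -/
def QSymNC (f : NCMon → ℚ) : Prop := ∀ u v : NCMon, u.std = v.std → f u = f v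

/-- Bounded degree. -/
def BddDeg (f : NCMon → ℚ) : Prop := ∃ N, ∀ u : NCMon, f u ≠ 0 → u.deg ≤ N

/-- The set of nonzero elements appearing in the blocks of a sequence of subsets. -/
def unionNZ (I : List (Finset ℕ)) : Finset ℕ := (I.foldr (· ∪ ·) ∅).erase 0

/-- A set supercomposition: a sequence of nonempty subsets of `{0, …, n}`, pairwise
intersecting in at most `{0}`, whose union minus `{0}` equals `{1, …, n}`. Blocks
containing `0` are the fermionic blocks. -/
def IsSSC (I : List (Finset ℕ)) : Prop :=
  (∀ B ∈ I, B.Nonempty) ∧ I.Pairwise (fun B C => B ∩ C ⊆ {0}) ∧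
    unionNZ I = Finset.Icc 1 (unionNZ I).card

/-- Shift of a block: add `n` to every positive element. -/
def shiftB (n : ℕ) (B : Finset ℕ) : Finset ℕ := B.image fun a => if a = 0 then 0 else a + n

/-- The `n`-shift `J[n]` of a set supercomposition. -/
def shiftC (n : ℕ) (J : List (Finset ℕ)) : List (Finset ℕ) := J.map (shiftB n)

/-- `L` is an interleaving (shuffle) of the block sequences `I` (tagged `false`) and `J`
(tagged `true`), preserving the relative order of the blocks of each. -/
def IsShuffle (I J : List (Finset ℕ)) (L : List (Bool × Finset ℕ)) : Prop :=
  ((L.filter fun p => !p.1).map Prod.snd) = I ∧ ((L.filter fun p => p.1).map Prod.snd) = J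

/-- `ε(L)`: the number of pairs of fermionic blocks `(I_i, J_j[n])` such that `J_j[n]`
appears before `I_i` in the tagged shuffle `L`. -/
def eps (L : List (Bool × Finset ℕ)) : ℕ :=
  ((Finset.range L.length ×ˢ Finset.range L.length).filter fun pq =>
    pq.1 < pq.2 ∧ (L.getD pq.1 (false, ∅)).1 = true ∧ 0 ∈ (L.getD pq.1 (false, ∅)).2 ∧
      (L.getD pq.2 (false, ∅)).1 = false ∧ 0 ∈ (L.getD pq.2 (false, ∅)).2).card

/-- Covering relation on set supercompositions: merge two adjacent non-fermionic blocks,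
every element of the first being smaller than every element of the second. -/
inductive SSCover : List (Finset ℕ) → List (Finset ℕ) → Prop
  | mk (pre post : List (Finset ℕ)) (B C : Finset ℕ) :
      0 ∉ B → 0 ∉ C → (∀ b ∈ B, ∀ c ∈ C, b < c) →
      SSCover (pre ++ B :: C :: post) (pre ++ (B ∪ C) :: post)

/-- The partial order on set supercompositions (reflexive-transitive closure of covering). -/
def SSle : List (Finset ℕ) → List (Finset ℕ) → Prop := Relation.ReflTransGen SSCover

/-- The `Q`-basis: `Q_I = ∑_{J ⪰ I} M_J` (a finite sum). -/
noncomputable def Qfn (I : List (Finset ℕ)) : NCMon → ℚ :=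
  ∑ᶠ (J : List (Finset ℕ)) (_ : SSle I J), Mfn J

/-- An increasing sequence of non-fermionic blocks: the maximum of each block is smaller
than the minimum of the next one. -/
def IncrRun (bs : List (Finset ℕ)) : Prop :=
  bs.Chain' (fun B C => ∀ b ∈ B, ∀ c ∈ C, b < c) ∧ ∀ B ∈ bs, 0 ∉ B

/-- `SMerge L K` : the set supercomposition `K` is obtained from the tagged shuffle `L` by
a possibly empty collection of pairwise disjoint mergers of consecutive blocks, where
either a fermionic block from `I` is followed by an increasing sequence of non-fermionic
blocks from `J`, or an increasing sequence of non-fermionic blocks from `I` is followed by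
a fermionic block from `J`, each merged group being replaced by its union. -/
inductive SMerge : List (Bool × Finset ℕ) → List (Finset ℕ) → Prop
  | nil : SMerge [] []
  | single (b : Bool) (B : Finset ℕ) (L : List (Bool × Finset ℕ)) (K : List (Finset ℕ)) :
      SMerge L K → SMerge ((b, B) :: L) (B :: K)
  | mergeI (B : Finset ℕ) (bs : List (Finset ℕ)) (L : List (Bool × Finset ℕ))
      (K : List (Finset ℕ)) :
      0 ∈ B → IncrRun bs → bs ≠ [] → SMerge L K →
      SMerge ((false, B) :: ((bs.map fun C => (true, C)) ++ L)) ((bs.foldr (· ∪ ·) B) :: K)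
  | mergeJ (bs : List (Finset ℕ)) (B : Finset ℕ) (L : List (Bool × Finset ℕ))
      (K : List (Finset ℕ)) :
      0 ∈ B → IncrRun bs → bs ≠ [] → SMerge L K →
      SMerge ((bs.map fun C => (false, C)) ++ ((true, B) :: L)) ((bs.foldr (· ∪ ·) B) :: K)

/-- The union of a list of blocks. -/
def blockUnion (g : List (Finset ℕ)) : Finset ℕ := g.foldr (· ∪ ·) ∅

@[simp] lemma blockUnion_nil : blockUnion [] = ∅ := rfl

@[simp] lemma blockUnion_cons (B : Finset ℕ) (g : List (Finset ℕ)) :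
    blockUnion (B :: g) = B ∪ blockUnion g := rfl

@[simp] lemma mem_blockUnion {x : ℕ} {g : List (Finset ℕ)} :
    x ∈ blockUnion g ↔ ∃ B ∈ g, x ∈ B := by
  induction g with
  | nil => simp
  | cons B g ih => simp [ih]

lemma blockUnion_append (g h : List (Finset ℕ)) :
    blockUnion (g ++ h) = blockUnion g ∪ blockUnion h := by
  ext x; simp only [mem_blockUnion, List.mem_append, Finset.mem_union, or_and_right, exists_or]

lemma foldr_union_eq (B : Finset ℕ) (g : List (Finset ℕ)) :
    g.foldr (· ∪ ·) B = B ∪ blockUnion g := by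
  induction g with
  | nil => simp
  | cons C g ih => rw [List.foldr_cons, ih, blockUnion_cons]; exact Finset.union_left_comm _ _ _

lemma mem_unionNZ {x : ℕ} {g : List (Finset ℕ)} :
    x ∈ unionNZ g ↔ x ≠ 0 ∧ ∃ B ∈ g, x ∈ B := by
  have : unionNZ g = (blockUnion g).erase 0 := rfl
  simp [this]

/-- A sequence of pairwise increasing non-fermionic blocks. -/
def IsIncr (g : List (Finset ℕ)) : Prop :=
  g.Pairwise (fun B C => ∀ b ∈ B, ∀ c ∈ C, b < c) ∧ ∀ B ∈ g, 0 ∉ B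

lemma IsIncr.incrRun {g : List (Finset ℕ)} (h : IsIncr g) : IncrRun g :=
  ⟨List.Pairwise.isChain h.1, h.2⟩

lemma IncrRun.isIncr {g : List (Finset ℕ)} (h : IncrRun g) (hne : ∀ B ∈ g, B.Nonempty) :
    IsIncr g := by
  obtain ⟨hc, h0⟩ := h
  refine ⟨?_, h0⟩
  have key : ∀ g : List (Finset ℕ), (∀ B ∈ g, B.Nonempty) →
      List.IsChain (fun B C => ∀ b ∈ B, ∀ c ∈ C, b < c) g →
      g.Pairwise (fun B C => ∀ b ∈ B, ∀ c ∈ C, b < c) := by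
    intro g
    induction g with
    | nil => simp
    | cons B g ih =>
      intro hne hc
      have ih' := ih (fun C hC => hne C (List.mem_cons_of_mem _ hC)) hc.tail
      refine List.pairwise_cons.2 ⟨?_, ih'⟩
      cases g with
      | nil => simp
      | cons C g =>
        have hBC := (List.isChain_cons_cons.1 hc).1
        intro E hE b hb e he
        rcases List.mem_cons.1 hE with rfl | hE
        · exact hBC b hb e he
        · obtain ⟨c, hc'⟩ := hne C (by simp)
          exact (hBC b hb c hc').trans ((List.pairwise_cons.1 ih').1 E hE c hc' e he)
  exact key g hne hc

lemma IsIncr.append {g h : List (Finset ℕ)} (hg : IsIncr g) (hh : IsIncr h)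
    (hgh : ∀ b ∈ blockUnion g, ∀ c ∈ blockUnion h, b < c) : IsIncr (g ++ h) := by
  refine ⟨List.pairwise_append.2 ⟨hg.1, hh.1, fun B hB C hC b hb c hc => ?_⟩, fun B hB => ?_⟩
  · exact hgh b (mem_blockUnion.2 ⟨B, hB, hb⟩) c (mem_blockUnion.2 ⟨C, hC, hc⟩)
  · rcases List.mem_append.1 hB with h' | h'
    · exact hg.2 B h'
    · exact hh.2 B h'

/-- A sequence of blocks which may be merged into a single block of a coarsening. -/
def IsGroup (g : List (Finset ℕ)) : Prop := IsIncr g ∨ ∃ B, g = [B] ∧ 0 ∈ B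

lemma isIncr_nil : IsIncr [] := by simp [IsIncr]

lemma isGroup_singleton (B : Finset ℕ) : IsGroup [B] := by
  by_cases h : 0 ∈ B
  · exact Or.inr ⟨B, rfl, h⟩
  · exact Or.inl ⟨by simp, by simpa using h⟩

lemma IsGroup.isIncr {g : List (Finset ℕ)} (h : IsGroup g) (h0 : 0 ∉ blockUnion g) :
    IsIncr g := by
  rcases h with h | ⟨B, rfl, h⟩
  · exact h
  · simp [h] at h0

lemma IsGroup.eq_singleton {g : List (Finset ℕ)} (h : IsGroup g) (h0 : 0 ∈ blockUnion g) :
    ∃ B, g = [B] ∧ 0 ∈ B := by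
  rcases h with h | h
  · obtain ⟨B, hB, h0⟩ := mem_blockUnion.1 h0
    exact absurd h0 (h.2 B hB)
  · exact h

/-- `P` is obtained from `I` by merging consecutive groups of blocks. -/
inductive Coarse : List (Finset ℕ) → List (Finset ℕ) → Prop
  | nil : Coarse [] []
  | cons (g I P : List (Finset ℕ)) : g ≠ [] → IsGroup g → Coarse I P →
      Coarse (g ++ I) (blockUnion g :: P)

lemma Coarse.refl (I : List (Finset ℕ)) : Coarse I I := by
  induction I with
  | nil => exact .nil
  | cons B I ih => simpa using Coarse.cons [B] I I (by simp) (isGroup_singleton B) ih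

lemma Coarse.append {I I' P P' : List (Finset ℕ)} (h : Coarse I P) (h' : Coarse I' P') :
    Coarse (I ++ I') (P ++ P') := by
  induction h with
  | nil => exact h'
  | cons g I P hg hG _ ih =>
    rw [List.append_assoc, List.cons_append]
    exact .cons _ _ _ hg hG ih

lemma coarse_nil_right {I : List (Finset ℕ)} (h : Coarse I []) : I = [] := by
  cases h; rfl

lemma coarse_cons_right {I P : List (Finset ℕ)} {A : Finset ℕ} (h : Coarse I (A :: P)) :
    ∃ g I', I = g ++ I' ∧ A = blockUnion g ∧ g ≠ [] ∧ IsGroup g ∧ Coarse I' P := by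
  cases h with
  | cons g I' P hg hG h => exact ⟨g, I', rfl, rfl, hg, hG, h⟩

lemma coarse_append_right {P P' : List (Finset ℕ)} : ∀ {I}, Coarse I (P ++ P') →
    ∃ I₁ I₂, I = I₁ ++ I₂ ∧ Coarse I₁ P ∧ Coarse I₂ P' := by
  induction P with
  | nil => exact fun {I} h => ⟨[], I, rfl, .nil, h⟩
  | cons A P ih =>
    intro I h
    obtain ⟨g, I', rfl, rfl, hg, hG, h⟩ := coarse_cons_right (by simpa using h)
    obtain ⟨I₁, I₂, rfl, h₁, h₂⟩ := ih h
    exact ⟨g ++ I₁, I₂, by simp, .cons _ _ _ hg hG h₁, h₂⟩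

lemma SSle.cons (B : Finset ℕ) {I P : List (Finset ℕ)} (h : SSle I P) :
    SSle (B :: I) (B :: P) := by
  induction h with
  | refl => exact .refl
  | tail _ hc ih =>
    refine ih.tail ?_
    cases hc with
    | mk pre post C E hC hE hlt => exact SSCover.mk (B :: pre) post C E hC hE hlt

lemma IsIncr.ssle (g : List (Finset ℕ)) : ∀ I, g ≠ [] → IsIncr g →
    SSle (g ++ I) (blockUnion g :: I) := by
  induction g with
  | nil => simp
  | cons B g ih =>
    intro I _ hg
    by_cases hn : g = []
    · subst hn; simp [SSle, Relation.ReflTransGen.refl]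
    obtain ⟨hp, h0⟩ := hg
    have h1 := (ih I hn ⟨(List.pairwise_cons.1 hp).2,
      fun C hC => h0 C (List.mem_cons_of_mem _ hC)⟩).cons B
    refine h1.tail ?_
    have := SSCover.mk [] I B (blockUnion g) (h0 B (by simp))
      (by
        intro h
        obtain ⟨C, hC, h⟩ := mem_blockUnion.1 h
        exact h0 C (List.mem_cons_of_mem _ hC) h)
      (by
        intro b hb c hc
        obtain ⟨C, hC, hc⟩ := mem_blockUnion.1 hc
        exact (List.pairwise_cons.1 hp).1 C hC b hb c hc)
    simpa using this

lemma Coarse.ssle {I P : List (Finset ℕ)} (h : Coarse I P) : SSle I P := by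
  induction h with
  | nil => exact .refl
  | cons g I P hg hG _ ih =>
    refine Relation.ReflTransGen.trans (b := blockUnion g :: I) ?_ (ih.cons _)
    rcases hG with hG | ⟨B, rfl, -⟩
    · exact hG.ssle g I hg
    · simpa using Relation.ReflTransGen.refl

lemma ssle_iff_coarse {I P : List (Finset ℕ)} : SSle I P ↔ Coarse I P := by
  refine ⟨fun h => ?_, Coarse.ssle⟩
  induction h with
  | refl => exact .refl I
  | tail _ hc ih =>
    cases hc with
    | mk pre post B C hB hC hlt =>
      obtain ⟨I₁, I₂, rfl, h₁, h₂⟩ := coarse_append_right ih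
      obtain ⟨g, I', rfl, rfl, hg, hG, h₃⟩ := coarse_cons_right h₂
      obtain ⟨g', I'', rfl, rfl, -, hG', h₄⟩ := coarse_cons_right h₃
      refine h₁.append ?_
      rw [← List.append_assoc, ← blockUnion_append]
      exact .cons _ _ _ (by simp [hg]) (Or.inl ((hG.isIncr hB).append (hG'.isIncr hC) hlt)) h₄

lemma Coarse.blockUnion_eq {I P : List (Finset ℕ)} (h : Coarse I P) :
    blockUnion I = blockUnion P := by
  induction h with
  | nil => rfl
  | cons g I P _ _ _ ih => rw [blockUnion_append, blockUnion_cons, ih]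

lemma Coarse.length_le {I P : List (Finset ℕ)} (h : Coarse I P) : P.length ≤ I.length := by
  induction h with
  | nil => rfl
  | cons g I P hg _ _ ih =>
    have := List.length_pos_iff.2 hg
    simp; omega

lemma IsGroup.eq_of_append_eq {g h r s : List (Finset ℕ)} (hg : IsGroup g) (hh : IsGroup h)
    (hne : ∀ B ∈ g ++ r, B.Nonempty) (heq : g ++ r = h ++ s)
    (hu : blockUnion g = blockUnion h) : g = h := by
  have key : ∀ g k : List (Finset ℕ), IsGroup (g ++ k) → (∀ B ∈ g ++ k, B.Nonempty) →
      blockUnion g = blockUnion (g ++ k) → k = [] := by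
    intro g k hG hne hu
    cases k with
    | nil => rfl
    | cons C k =>
      exfalso
      obtain ⟨x, hx⟩ := hne C (by simp)
      have hxg : x ∈ blockUnion g := by rw [hu, mem_blockUnion]; exact ⟨C, by simp, hx⟩
      obtain ⟨B, hB, hxB⟩ := mem_blockUnion.1 hxg
      rcases hG with hG | ⟨E, hE, -⟩
      · exact lt_irrefl _ ((List.pairwise_append.1 hG.1).2.2 B hB C (by simp) x hxB x hx)
      · have := congrArg List.length hE
        have := List.length_pos_of_mem hB
        simp at *; omega
  rcases List.append_eq_append_iff.1 heq with ⟨k, rfl, rfl⟩ | ⟨k, rfl, rfl⟩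
  · have := key g k hh (fun B hB => hne B (by simp at hB ⊢; tauto)) hu
    simp [this]
  · have := key h k hg (fun B hB => hne B (List.mem_append_left _ hB)) hu.symm
    simp [this]

/-- The blocks of a tagged shuffle carrying the tag `b`. -/
def tagged (b : Bool) (L : List (Bool × Finset ℕ)) : List (Finset ℕ) :=
  (L.filter fun p => p.1 == b).map Prod.snd

/-- The result of merging a group `g` of blocks from `I` and a group `h` of blocks from `J`:
a single block if one of them is fermionic, their concatenation otherwise. -/
def joinGroups (g h : List (Finset ℕ)) : List (Finset ℕ) :=
  if 0 ∈ blockUnion g ∪ blockUnion h then [blockUnion g ∪ blockUnion h] else g ++ h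

/-- The tagged shuffle `L` and super-shuffle `K` determined by a sequence `D` of pairs of blocks,
the first components being unions of groups of blocks from `I`, the second ones unions of
groups of blocks from `J`. -/
inductive Assembled :
    List (Finset ℕ × Finset ℕ) → List (Bool × Finset ℕ) → List (Finset ℕ) → Prop
  | nil : Assembled [] [] []
  | cons (g h : List (Finset ℕ)) (D : List (Finset ℕ × Finset ℕ)) (L : List (Bool × Finset ℕ))
      (K : List (Finset ℕ)) :
      IsGroup g → IsGroup h → g ++ h ≠ [] → ¬ (0 ∈ blockUnion g ∧ 0 ∈ blockUnion h) →
      Assembled D L K →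
      Assembled ((blockUnion g, blockUnion h) :: D)
        (g.map (fun C => (false, C)) ++ (h.map (fun C => (true, C)) ++ L)) (joinGroups g h ++ K)

@[simp] lemma tagged_append (b : Bool) (L L' : List (Bool × Finset ℕ)) :
    tagged b (L ++ L') = tagged b L ++ tagged b L' := by simp [tagged]

lemma tagged_map (b c : Bool) (g : List (Finset ℕ)) :
    tagged b (g.map fun C => (c, C)) = if c = b then g else [] := by
  induction g with
  | nil => simp [tagged]
  | cons B g ih =>
    unfold tagged at ih ⊢
    cases b <;> cases c <;> simp_all

lemma tagged_false_glue (g h : List (Finset ℕ)) (L : List (Bool × Finset ℕ)) :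
    tagged false (g.map (fun C => (false, C)) ++ (h.map (fun C => (true, C)) ++ L)) =
      g ++ tagged false L := by
  simp [tagged_map]

lemma tagged_true_glue (g h : List (Finset ℕ)) (L : List (Bool × Finset ℕ)) :
    tagged true (g.map (fun C => (false, C)) ++ (h.map (fun C => (true, C)) ++ L)) =
      h ++ tagged true L := by
  simp [tagged_map]

lemma mem_tagged {b : Bool} {L : List (Bool × Finset ℕ)} {B : Finset ℕ} :
    B ∈ tagged b L ↔ (b, B) ∈ L := by
  simp [tagged]

lemma isShuffle_iff {I J : List (Finset ℕ)} {L : List (Bool × Finset ℕ)} :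
    IsShuffle I J L ↔ tagged false L = I ∧ tagged true L = J := by
  have h1 : (fun p : Bool × Finset ℕ => p.1 == false) = fun p => !p.1 := by
    funext p; cases p.1 <;> rfl
  have h2 : (fun p : Bool × Finset ℕ => p.1 == true) = fun p => p.1 := by
    funext p; cases p.1 <;> rfl
  rw [IsShuffle, tagged, tagged, h1, h2]

/-- The blocks tagged `false` have entries at most `n`, and the positive entries of the blocks
tagged `true` are larger than `n`. -/
def Separated (n : ℕ) (L : List (Bool × Finset ℕ)) : Prop :=
  (∀ B ∈ tagged false L, ∀ x ∈ B, x ≤ n) ∧ ∀ B ∈ tagged true L, ∀ x ∈ B, x = 0 ∨ n < x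

lemma Separated.right {n : ℕ} {L L' : List (Bool × Finset ℕ)} (h : Separated n (L ++ L')) :
    Separated n L' :=
  ⟨fun B hB => h.1 B (by simp [hB]), fun B hB => h.2 B (by simp [hB])⟩

lemma Separated.left {n : ℕ} {L L' : List (Bool × Finset ℕ)} (h : Separated n (L ++ L')) :
    Separated n L :=
  ⟨fun B hB => h.1 B (by simp [hB]), fun B hB => h.2 B (by simp [hB])⟩

lemma smerge_singles (b : Bool) (g : List (Finset ℕ)) {L : List (Bool × Finset ℕ)}
    {K : List (Finset ℕ)} (h : SMerge L K) :
    SMerge (g.map (fun C => (b, C)) ++ L) (g ++ K) := by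
  induction g with
  | nil => exact h
  | cons B g ih => exact .single b B _ _ ih

lemma Assembled.smerge {D : List (Finset ℕ × Finset ℕ)} {L : List (Bool × Finset ℕ)}
    {K : List (Finset ℕ)} (h : Assembled D L K) : SMerge L K := by
  induction h with
  | nil => exact .nil
  | cons g h D L K hg hh hne h0 _ ih =>
    unfold joinGroups
    split_ifs with hF
    · rcases Finset.mem_union.1 hF with hF | hF
      · obtain ⟨B, rfl, hB⟩ := hg.eq_singleton hF
        have hh' := hh.isIncr fun h' => h0 ⟨hF, h'⟩
        by_cases hn : h = []
        · subst hn; simpa using SMerge.single false B L K ih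
        · simpa [foldr_union_eq] using SMerge.mergeI B h L K hB hh'.incrRun hn ih
      · obtain ⟨B, rfl, hB⟩ := hh.eq_singleton hF
        have hg' := hg.isIncr fun h' => h0 ⟨h', hF⟩
        by_cases hn : g = []
        · subst hn; simpa using SMerge.single true B L K ih
        · simpa [foldr_union_eq, Finset.union_comm] using
            SMerge.mergeJ g B L K hB hg'.incrRun hn ih
    · rw [List.append_assoc]
      exact smerge_singles _ _ (smerge_singles _ _ ih)

lemma Assembled.coarse {n : ℕ} {D : List (Finset ℕ × Finset ℕ)} {L : List (Bool × Finset ℕ)}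
    {K : List (Finset ℕ)} (h : Assembled D L K) (hs : Separated n L) :
    Coarse K (D.map fun p => p.1 ∪ p.2) := by
  induction h with
  | nil => exact .nil
  | cons g h D L K hg hh hne h0 _ ih =>
    have ih' := ih hs.right.right
    rw [List.map_cons]
    unfold joinGroups
    split_ifs with hF
    · simpa using Coarse.cons [blockUnion g ∪ blockUnion h] _ _ (by simp)
        (isGroup_singleton _) ih'
    · simp only [Finset.mem_union, not_or] at hF
      rw [← blockUnion_append]
      refine .cons _ _ _ hne (Or.inl ((hg.isIncr hF.1).append (hh.isIncr hF.2) ?_)) ih'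
      intro b hb c hc
      obtain ⟨B, hB, hb⟩ := mem_blockUnion.1 hb
      obtain ⟨C, hC, hc'⟩ := mem_blockUnion.1 hc
      have h1 := hs.1 B (by rw [tagged_false_glue]; simp [hB]) b hb
      have h2 := hs.2 C (by rw [tagged_true_glue]; simp [hC]) c hc'
      have h3 : c ≠ 0 := fun h => hF.2 (h ▸ hc)
      omega

lemma blockUnion_eq_empty {g : List (Finset ℕ)} (hne : ∀ B ∈ g, B.Nonempty) :
    blockUnion g = ∅ ↔ g = [] := by
  refine ⟨fun h => ?_, fun h => h ▸ rfl⟩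
  cases g with
  | nil => rfl
  | cons B g =>
    obtain ⟨x, hx⟩ := hne B (by simp)
    have : x ∈ blockUnion (B :: g) := by simp [hx]
    simp [h] at this

lemma Coarse.cons_filter {g I : List (Finset ℕ)} {P : List (Finset ℕ)}
    (hG : IsGroup g) (hne : ∀ B ∈ g, B.Nonempty) (h : Coarse I (P.filter (· ≠ ∅))) :
    Coarse (g ++ I) ((blockUnion g :: P).filter (· ≠ ∅)) := by
  by_cases hg : g = []
  · subst hg; simpa using h
  · rw [List.filter_cons_of_pos (by simpa using (blockUnion_eq_empty hne).not.2 hg)]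
    exact .cons _ _ _ hg hG h

lemma coarse_filter_cons {I P : List (Finset ℕ)} {A : Finset ℕ}
    (h : Coarse I ((A :: P).filter (· ≠ ∅))) :
    ∃ g I', I = g ++ I' ∧ A = blockUnion g ∧ IsGroup g ∧ Coarse I' (P.filter (· ≠ ∅)) := by
  by_cases hA : A = ∅
  · subst hA
    exact ⟨[], I, rfl, rfl, Or.inl isIncr_nil, by simpa using h⟩
  · rw [List.filter_cons_of_pos (by simpa using hA)] at h
    obtain ⟨g, I', h1, h2, -, h3, h4⟩ := coarse_cons_right h
    exact ⟨g, I', h1, h2, h3, h4⟩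

lemma Assembled.coarse_fst {D : List (Finset ℕ × Finset ℕ)} {L : List (Bool × Finset ℕ)}
    {K : List (Finset ℕ)} (h : Assembled D L K) (hne : ∀ B ∈ tagged false L, B.Nonempty) :
    Coarse (tagged false L) ((D.map Prod.fst).filter (· ≠ ∅)) := by
  induction h with
  | nil => exact .nil
  | cons g h D L K hg hh _ h0 _ ih =>
    rw [tagged_false_glue] at hne ⊢
    exact Coarse.cons_filter hg (fun B hB => hne B (by simp [hB]))
      (ih fun B hB => hne B (by simp [hB]))

lemma Assembled.coarse_snd {D : List (Finset ℕ × Finset ℕ)} {L : List (Bool × Finset ℕ)}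
    {K : List (Finset ℕ)} (h : Assembled D L K) (hne : ∀ B ∈ tagged true L, B.Nonempty) :
    Coarse (tagged true L) ((D.map Prod.snd).filter (· ≠ ∅)) := by
  induction h with
  | nil => exact .nil
  | cons g h D L K hg hh _ h0 _ ih =>
    rw [tagged_true_glue] at hne ⊢
    exact Coarse.cons_filter hh (fun B hB => hne B (by simp [hB]))
      (ih fun B hB => hne B (by simp [hB]))

lemma exists_assembled {D : List (Finset ℕ × Finset ℕ)}
    (hD : ∀ p ∈ D, p.1 ∪ p.2 ≠ ∅ ∧ ¬ (0 ∈ p.1 ∧ 0 ∈ p.2)) :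
    ∀ {I J : List (Finset ℕ)}, Coarse I ((D.map Prod.fst).filter (· ≠ ∅)) →
      Coarse J ((D.map Prod.snd).filter (· ≠ ∅)) →
      ∃ L K, Assembled D L K ∧ tagged false L = I ∧ tagged true L = J := by
  induction D with
  | nil =>
    intro I J hI hJ
    rw [coarse_nil_right hI, coarse_nil_right hJ]
    exact ⟨[], [], .nil, rfl, rfl⟩
  | cons p D ih =>
    intro I J hI hJ
    obtain ⟨A, B⟩ := p
    obtain ⟨g, I', rfl, rfl, hg, hI'⟩ := coarse_filter_cons hI
    obtain ⟨h, J', rfl, rfl, hh, hJ'⟩ := coarse_filter_cons hJ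
    obtain ⟨L, K, hA, rfl, rfl⟩ := ih (fun p hp => hD p (List.mem_cons_of_mem _ hp)) hI' hJ'
    have hp := hD _ List.mem_cons_self
    refine ⟨_, _, .cons g h D L K hg hh ?_ hp.2 hA, tagged_false_glue _ _ _,
      tagged_true_glue _ _ _⟩
    intro h'
    rw [List.append_eq_nil_iff] at h'
    apply hp.1
    simp [h'.1, h'.2]

lemma Assembled.unique {D : List (Finset ℕ × Finset ℕ)} {L : List (Bool × Finset ℕ)}
    {K : List (Finset ℕ)} (h : Assembled D L K) :
    ∀ {L' : List (Bool × Finset ℕ)} {K' : List (Finset ℕ)}, Assembled D L' K' →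
      (∀ b, ∀ B ∈ tagged b L, B.Nonempty) → (∀ b, tagged b L = tagged b L') →
      L = L' ∧ K = K' := by
  induction h with
  | nil => intro L' K' h' _ _; cases h'; exact ⟨rfl, rfl⟩
  | cons g h D L K hg hh _ _ _ ih =>
    intro L' K' h' hne heq
    generalize hD : (blockUnion g, blockUnion h) :: D = D' at h'
    cases h' with
    | nil => cases hD
    | cons g' h'' D' L' K' hg' hh' _ _ hA =>
      obtain ⟨hD1, rfl⟩ := List.cons.inj hD
      obtain ⟨hu, hv⟩ := Prod.mk.inj hD1
      have e1 := heq false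
      have e2 := heq true
      have n1 := hne false
      have n2 := hne true
      rw [tagged_false_glue] at e1 n1
      rw [tagged_false_glue] at e1
      rw [tagged_true_glue] at e2 n2
      rw [tagged_true_glue] at e2
      obtain rfl := hg.eq_of_append_eq hg' n1 e1 hu
      obtain rfl := hh.eq_of_append_eq hh' n2 e2 hv
      have := ih hA (fun b B hB => by
        cases b
        · exact n1 B (List.mem_append_right _ hB)
        · exact n2 B (List.mem_append_right _ hB)) (fun b => by
        cases b
        · exact List.append_cancel_left e1
        · exact List.append_cancel_left e2)
      rw [this.1, this.2]
      exact ⟨rfl, rfl⟩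

lemma smerge_fermionic {L : List (Bool × Finset ℕ)} {B : Finset ℕ} {K : List (Finset ℕ)}
    (h : SMerge L (B :: K)) (h0 : 0 ∈ B) (hne : ∀ b, ∀ B ∈ tagged b L, B.Nonempty) :
    ∃ g h L', L = g.map (fun C => (false, C)) ++ (h.map (fun C => (true, C)) ++ L') ∧
      IsGroup g ∧ IsGroup h ∧ g ++ h ≠ [] ∧ ¬ (0 ∈ blockUnion g ∧ 0 ∈ blockUnion h) ∧
      B = blockUnion g ∪ blockUnion h ∧ SMerge L' K := by
  have h0' : ∀ g, IsIncr g → 0 ∉ blockUnion g := fun g hg h => by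
    obtain ⟨C, hC, h⟩ := mem_blockUnion.1 h
    exact hg.2 C hC h
  cases h with
  | single b _ L' _ h =>
    cases b
    · exact ⟨[B], [], L', rfl, isGroup_singleton B, Or.inl isIncr_nil, by simp, by simp,
        by simp, h⟩
    · exact ⟨[], [B], L', rfl, Or.inl isIncr_nil, isGroup_singleton B, by simp, by simp,
        by simp, h⟩
  | mergeI B bs L' _ hB hbs _ h =>
    have hi := hbs.isIncr fun C hC => hne true C (by simp [mem_tagged, hC])
    exact ⟨[B], bs, L', rfl, isGroup_singleton B, Or.inl hi, by simp,
      fun h => h0' _ hi h.2, by simp [foldr_union_eq], h⟩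
  | mergeJ bs B L' _ hB hbs _ h =>
    have hi := hbs.isIncr fun C hC => hne false C (by simp [mem_tagged, hC])
    exact ⟨bs, [B], L', rfl, Or.inl hi, isGroup_singleton B, by simp,
      fun h => h0' _ hi h.1, by simp [foldr_union_eq, Finset.union_comm], h⟩

lemma smerge_nonfermionic {g : List (Finset ℕ)} (hg : ∀ B ∈ g, 0 ∉ B) :
    ∀ {L : List (Bool × Finset ℕ)} {K : List (Finset ℕ)}, SMerge L (g ++ K) →
      ∃ L₀ L', L = L₀ ++ L' ∧ L₀.map Prod.snd = g ∧ SMerge L' K := by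
  induction g with
  | nil => exact fun {L K} h => ⟨[], L, rfl, rfl, h⟩
  | cons B g ih =>
    intro L K h
    have hB : 0 ∉ B := hg B (by simp)
    rw [List.cons_append] at h
    generalize hX : B :: (g ++ K) = X at h
    cases h with
    | nil => cases hX
    | single b C L' K' h =>
      obtain ⟨rfl, rfl⟩ := List.cons.inj hX
      obtain ⟨L₀, L', rfl, rfl, h'⟩ := ih (fun C hC => hg C (by simp [hC])) h
      exact ⟨(b, B) :: L₀, L', rfl, rfl, h'⟩
    | mergeI C bs L' K' hC =>
      obtain ⟨rfl, rfl⟩ := List.cons.inj hX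
      rw [foldr_union_eq] at hB; simp [hC] at hB
    | mergeJ bs C L' K' hC =>
      obtain ⟨rfl, rfl⟩ := List.cons.inj hX
      rw [foldr_union_eq] at hB; simp [hC] at hB

lemma IsIncr.tail {B : Finset ℕ} {g : List (Finset ℕ)} (h : IsIncr (B :: g)) : IsIncr g :=
  ⟨(List.pairwise_cons.1 h.1).2, fun C hC => h.2 C (by simp [hC])⟩

lemma IsIncr.split {n : ℕ} {L : List (Bool × Finset ℕ)} (hi : IsIncr (L.map Prod.snd))
    (hs : Separated n L) (hne : ∀ b, ∀ B ∈ tagged b L, B.Nonempty) :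
    ∃ g h, L = g.map (fun C => (false, C)) ++ h.map (fun C => (true, C)) ∧
      IsIncr g ∧ IsIncr h := by
  induction L with
  | nil => exact ⟨[], [], rfl, isIncr_nil, isIncr_nil⟩
  | cons p L ih =>
    have hs' : Separated n L := Separated.right (L := [p]) hs
    rw [List.map_cons] at hi
    obtain ⟨g, h, rfl, hg, hh⟩ := ih hi.tail hs' fun b B hB => hne b B (by
      rw [mem_tagged] at hB ⊢; simp [hB])
    obtain ⟨b, B⟩ := p
    cases b
    · refine ⟨B :: g, h, rfl, ?_, hh⟩
      simp only [List.map_append, List.map_map] at hi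
      refine ⟨List.Pairwise.sublist ?_ hi.1, fun C hC => hi.2 C ?_⟩
      · have : (Prod.snd ∘ fun C : Finset ℕ => (false, C)) = id := rfl
        simp [this]
      · simpa using (List.mem_cons.1 hC).imp_right Or.inl
    · cases g with
      | nil =>
        refine ⟨[], B :: h, rfl, isIncr_nil, ?_⟩
        have : (Prod.snd ∘ fun C : Finset ℕ => (true, C)) = id := rfl
        simpa [this] using hi
      | cons C g =>
        exfalso
        obtain ⟨x, hx⟩ := hne true B (by simp [mem_tagged])
        obtain ⟨y, hy⟩ := hne false C (by simp [mem_tagged])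
        have h1 := (List.pairwise_cons.1 hi.1).1 C (by simp) x hx y hy
        have h2 := hs.1 C (by simp [mem_tagged]) y hy
        have h3 := hs.2 B (by simp [mem_tagged]) x hx
        have h4 : x ≠ 0 := fun h => hi.2 B (by simp) (h ▸ hx)
        omega

lemma SMerge.exists_assembled {n : ℕ} {P : List (Finset ℕ)} :
    ∀ {L : List (Bool × Finset ℕ)} {K : List (Finset ℕ)}, SMerge L K → Coarse K P →
      Separated n L → (∀ b, ∀ B ∈ tagged b L, B.Nonempty) →
      ∃ D, Assembled D L K ∧ D.map (fun p => p.1 ∪ p.2) = P := by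
  induction P with
  | nil =>
    intro L K h hK _ _
    obtain rfl := coarse_nil_right hK
    cases h
    exact ⟨[], .nil, rfl⟩
  | cons A P ih =>
    intro L K hLK hK hs hne
    obtain ⟨k, K', rfl, rfl, hk, hG, hK'⟩ := coarse_cons_right hK
    suffices ∃ g h L', L = g.map (fun C => (false, C)) ++ (h.map (fun C => (true, C)) ++ L') ∧
      IsGroup g ∧ IsGroup h ∧ g ++ h ≠ [] ∧ ¬ (0 ∈ blockUnion g ∧ 0 ∈ blockUnion h) ∧
      blockUnion k = blockUnion g ∪ blockUnion h ∧ k = joinGroups g h ∧ SMerge L' K' by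
      obtain ⟨g, h, L', rfl, hg, hh, hgh, h0, hu, hj, hm⟩ := this
      obtain ⟨D, hD, rfl⟩ := ih hm hK' hs.right.right fun b B hB => hne b B (by simp [hB])
      refine ⟨_, hj.symm ▸ Assembled.cons g h D L' K' hg hh hgh h0 hD, ?_⟩
      simp [hu]
    by_cases hF : 0 ∈ blockUnion k
    · obtain ⟨B, rfl, hB⟩ := hG.eq_singleton hF
      obtain ⟨g, h, L', rfl, hg, hh, hgh, h0, hu, hm⟩ := smerge_fermionic hLK hB hne
      refine ⟨g, h, L', rfl, hg, hh, hgh, h0, by simpa using hu, ?_, hm⟩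
      rw [joinGroups, ← hu, if_pos hB]
    · have hI := hG.isIncr hF
      obtain ⟨L₀, L', rfl, rfl, hm⟩ := smerge_nonfermionic hI.2 hLK
      obtain ⟨g, h, rfl, hg, hh⟩ := hI.split hs.left fun b B hB => hne b B (by simp [hB])
      have hk' : List.map Prod.snd (g.map (fun C => (false, C)) ++ h.map (fun C => (true, C))) =
          g ++ h := by
        have h1 : (Prod.snd ∘ fun C : Finset ℕ => (true, C)) = id := rfl
        have h2 : (Prod.snd ∘ fun C : Finset ℕ => (false, C)) = id := rfl
        simp [h1, h2]
      rw [hk'] at hk hF ⊢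
      rw [blockUnion_append] at hF ⊢
      refine ⟨g, h, L', by simp, Or.inl hg, Or.inl hh, hk, ?_, rfl, ?_, hm⟩
      · exact fun h => hF (Finset.mem_union_left _ h.1)
      · rw [joinGroups, if_neg hF]

/-- The tags of the fermionic blocks of a tagged shuffle. -/
def fermionTags (L : List (Bool × Finset ℕ)) : List Bool :=
  (L.filter fun p => 0 ∈ p.2).map Prod.fst

/-- The number of inversions (a `true` before a `false`) of a list of booleans. -/
def boolInv : List Bool → ℕ
  | [] => 0
  | b :: l => (if b then l.count false else 0) + boolInv l

lemma card_range_filter_getD {α : Type*} (d : α) (p : α → Prop) [DecidablePred p] (l : List α) :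
    ((Finset.range l.length).filter fun i => p (l.getD i d)).card = (l.filter p).length := by
  induction l with
  | nil => simp
  | cons a l ih =>
    rw [Finset.card_filter] at ih ⊢
    rw [List.length_cons, Finset.sum_range_succ']
    simp only [List.getD_cons_succ, List.getD_cons_zero, ih, List.filter_cons]
    by_cases h : p a <;> simp [h]

lemma eps_cons (x : Bool × Finset ℕ) (L : List (Bool × Finset ℕ)) :
    eps (x :: L) = (if x.1 = true ∧ 0 ∈ x.2 then
      (L.filter fun p => p.1 = false ∧ 0 ∈ p.2).length else 0) + eps L := by
  rw [← card_range_filter_getD (false, ∅)]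
  unfold eps
  rw [Finset.card_filter, Finset.card_filter, Finset.card_filter, Finset.sum_product,
    Finset.sum_product, List.length_cons, Finset.sum_range_succ']
  rw [add_comm]
  congr 1
  · rw [Finset.sum_range_succ']
    simp only [List.getD_cons_succ, List.getD_cons_zero, Nat.zero_lt_succ, lt_irrefl, true_and,
      false_and, if_false, add_zero]
    by_cases h : x.1 = true ∧ 0 ∈ x.2
    · simp only [h, true_and, if_true]
    · rw [if_neg h]
      exact Finset.sum_eq_zero fun j _ => if_neg fun hq => h ⟨hq.1, hq.2.1⟩
  · refine Finset.sum_congr rfl fun i _ => ?_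
    rw [Finset.sum_range_succ']
    simp only [List.getD_cons_succ, Nat.not_lt_zero, false_and, if_false, add_zero,
      Nat.add_lt_add_iff_right]

lemma eps_eq_boolInv (L : List (Bool × Finset ℕ)) : eps L = boolInv (fermionTags L) := by
  induction L with
  | nil => simp [eps, fermionTags, boolInv]
  | cons x L ih =>
    have hc : (fermionTags L).count false =
        (L.filter fun p => p.1 = false ∧ 0 ∈ p.2).length := by
      rw [fermionTags, List.count, List.countP_map, List.countP_filter,
        List.countP_eq_length_filter]
      congr 2
      funext p
      simp
    rw [eps_cons, ih, ← hc]
    obtain ⟨b, B⟩ := x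
    by_cases hB : 0 ∈ B
    · have : fermionTags ((b, B) :: L) = b :: fermionTags L := by simp [fermionTags, hB]
      simp [this, boolInv, hB]
    · have : fermionTags ((b, B) :: L) = fermionTags L := by simp [fermionTags, hB]
      simp [this, hB]

lemma fermionTags_append (L L' : List (Bool × Finset ℕ)) :
    fermionTags (L ++ L') = fermionTags L ++ fermionTags L' := by simp [fermionTags]

lemma IsGroup.fermionTags {g : List (Finset ℕ)} (hg : IsGroup g) (b : Bool) :
    fermionTags (g.map fun C => (b, C)) = if 0 ∈ blockUnion g then [b] else [] := by
  split_ifs with h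
  · obtain ⟨B, rfl, hB⟩ := hg.eq_singleton h
    simp [_root_.fermionTags, hB]
  · have := (hg.isIncr h).2
    simp only [_root_.fermionTags, List.map_eq_nil_iff, List.filter_eq_nil_iff, List.mem_map]
    rintro _ ⟨C, hC, rfl⟩
    simpa using this C hC

lemma Assembled.fermionTags {D : List (Finset ℕ × Finset ℕ)} {L : List (Bool × Finset ℕ)}
    {K : List (Finset ℕ)} (h : Assembled D L K) :
    fermionTags L = (D.filter fun p => 0 ∈ p.1 ∪ p.2).map fun p => decide (0 ∈ p.2) := by
  induction h with
  | nil => rfl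
  | cons g h D L K hg hh _ h0 _ ih =>
    rw [fermionTags_append, fermionTags_append, hg.fermionTags, hh.fermionTags, ih]
    by_cases h1 : 0 ∈ blockUnion g
    · have h2 : 0 ∉ blockUnion h := fun h' => h0 ⟨h1, h'⟩
      rw [List.filter_cons_of_pos (by simp only [Finset.mem_union, h1]; simp)]
      simp only [h1, h2, if_true, if_false, List.map_cons, decide_false,
          List.nil_append, List.singleton_append]
    · by_cases h2 : 0 ∈ blockUnion h
      · rw [List.filter_cons_of_pos (by simp only [Finset.mem_union, h2]; simp)]
        simp only [h1, h2, if_true, if_false, List.map_cons, decide_true,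
          List.nil_append, List.singleton_append]
      · rw [List.filter_cons_of_neg (by simp only [Finset.mem_union, h1, h2]; simp)]
        simp only [h1, h2, if_false, List.nil_append]

lemma invST_toFinset (p : ℕ → Prop) [DecidablePred p] {l : List ℕ} (hl : l.Pairwise (· < ·)) :
    invST (l.toFinset.filter p) (l.toFinset.filter fun a => ¬ p a) =
      boolInv (l.map fun a => decide (¬ p a)) := by
  induction l with
  | nil => simp [invST, boolInv]
  | cons a l ih =>
    obtain ⟨ha, hl⟩ := List.pairwise_cons.1 hl
    have hal : a ∉ l := fun h => lt_irrefl _ (ha a h)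
    have hal' : a ∉ l.toFinset := by simpa using hal
    rw [List.map_cons, boolInv, ← ih hl]
    unfold invST
    rw [List.toFinset_cons, Finset.filter_insert, Finset.filter_insert]
    by_cases hp : p a
    · simp only [hp, not_true_eq_false, if_true, if_false, decide_false, Bool.false_eq_true,
        zero_add]
      congr 1
      ext ⟨s, t⟩
      simp only [Finset.mem_filter, Finset.mem_product, Finset.mem_insert, List.mem_toFinset]
      constructor
      · rintro ⟨⟨rfl | h1, h2⟩, h3⟩
        · have := ha t h2.1; omega
        · exact ⟨⟨h1, h2⟩, h3⟩
      · rintro ⟨⟨h1, h2⟩, h3⟩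
        exact ⟨⟨Or.inr h1, h2⟩, h3⟩
    · simp only [hp, not_false_eq_true, if_true, if_false, decide_true]
      have hcount : (l.map fun a => decide (¬ p a)).count false =
          (l.toFinset.filter p).card := by
        have hnd : l.Nodup := hl.imp fun h => h.ne
        have hf : l.toFinset.filter p = (l.filter p).toFinset := by ext b; simp
        rw [hf, List.toFinset_card_of_nodup (hnd.filter _), List.count,
          List.countP_map, List.countP_eq_length_filter]
        congr 2
        funext b
        by_cases hb : p b <;> simp [hb]
      rw [hcount, Finset.card_filter, Finset.sum_product,
        Finset.card_filter (fun p : ℕ × ℕ => p.2 < p.1),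
        Finset.sum_product, Finset.card_eq_sum_ones, ← Finset.sum_add_distrib]
      refine Finset.sum_congr rfl fun s hs => ?_
      have hs' : a < s := ha s (by simpa using (Finset.mem_filter.1 hs).1)
      rw [Finset.sum_insert (by simp [hal])]
      simp [hs']

/-- The block of positions of the index `a` in the monomial `u`, containing `0` if `a` is a
θ-index. -/
def NCMon.block (u : NCMon) (a : ℕ) : Finset ℕ :=
  (((Finset.range u.w.length).filter fun t => u.w.getD t 0 = a).image (· + 1))
    ∪ (if a ∈ u.S then ({0} : Finset ℕ) else ∅)

lemma NCMon.mem_block {u : NCMon} {a x : ℕ} :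
    x ∈ u.block a ↔ (∃ t, u.w[t]? = some a ∧ t + 1 = x) ∨ (x = 0 ∧ a ∈ u.S) := by
  unfold NCMon.block
  rw [Finset.mem_union]
  refine or_congr ?_ ?_
  · simp only [Finset.mem_image, Finset.mem_filter, Finset.mem_range, List.getD_eq_getElem?_getD]
    refine exists_congr fun t => and_congr_left fun _ => ?_
    constructor
    · rintro ⟨h1, h2⟩
      rw [List.getElem?_eq_getElem h1] at h2 ⊢
      simpa using h2
    · intro h
      rw [h]
      exact ⟨(List.getElem?_eq_some_iff.1 h).1, rfl⟩
  · split_ifs with h <;> simp [h]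

lemma NCMon.zero_mem_block {u : NCMon} {a : ℕ} : 0 ∈ u.block a ↔ a ∈ u.S := by
  simp [NCMon.mem_block]

lemma NCMon.block_ne_empty {u : NCMon} {a : ℕ} : u.block a ≠ ∅ ↔ a ∈ u.ind := by
  rw [← Finset.nonempty_iff_ne_empty, NCMon.ind, Finset.mem_union, List.mem_toFinset,
    List.mem_iff_getElem?]
  constructor
  · rintro ⟨x, hx⟩
    rcases NCMon.mem_block.1 hx with ⟨t, h, -⟩ | ⟨-, h⟩
    · exact Or.inr ⟨t, h⟩
    · exact Or.inl h
  · rintro (h | ⟨t, h⟩)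
    · exact ⟨0, NCMon.mem_block.2 (Or.inr ⟨rfl, h⟩)⟩
    · exact ⟨t + 1, NCMon.mem_block.2 (Or.inl ⟨t, h, rfl⟩)⟩

lemma countP_le_getElem {l : List ℕ} (hl : l.Pairwise (· < ·)) (i : ℕ) (hi : i < l.length) :
    l.countP (· ≤ l[i]) = i + 1 := by
  induction l generalizing i with
  | nil => simp at hi
  | cons a l ih =>
    obtain ⟨ha, hl⟩ := List.pairwise_cons.1 hl
    cases i with
    | zero =>
      have : l.countP (· ≤ a) = 0 := by
        rw [List.countP_eq_zero]
        intro b hb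
        simpa using ha b hb
      simp [this]
    | succ i =>
      have hi' : i < l.length := by simpa using hi
      have := ha l[i] (List.getElem_mem hi')
      simp [ih hl i hi', this.le]

lemma sort_pairwise_lt (A : Finset ℕ) : (A.sort (· ≤ ·)).Pairwise (· < ·) :=
  (Finset.sortedLT_sort A).pairwise

lemma rk_sort_getElem (A : Finset ℕ) (i : ℕ) (hi : i < (A.sort (· ≤ ·)).length) :
    rk A (A.sort (· ≤ ·))[i] = i + 1 := by
  rw [← countP_le_getElem (sort_pairwise_lt A) i hi, rk, List.countP_eq_length_filter,
    ← List.toFinset_card_of_nodup ((Finset.sort_nodup A _).filter _), List.toFinset_filter,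
    Finset.sort_toFinset]
  simp

lemma rk_eq_iff {A : Finset ℕ} {a b : ℕ} (ha : a ∈ A) (hb : b ∈ A) :
    rk A a = rk A b ↔ a = b := by
  refine ⟨fun h => ?_, fun h => h ▸ rfl⟩
  obtain ⟨i, hi, rfl⟩ := List.getElem_of_mem ((Finset.mem_sort (· ≤ ·)).2 ha)
  obtain ⟨j, hj, rfl⟩ := List.getElem_of_mem ((Finset.mem_sort (· ≤ ·)).2 hb)
  rw [rk_sort_getElem, rk_sort_getElem] at h
  obtain rfl : i = j := by omega
  rfl

lemma NCMon.scomp_eq (u : NCMon) : u.scomp = (u.ind.sort (· ≤ ·)).map u.block := by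
  refine List.ext_getElem (by simp [NCMon.scomp]) fun i h1 h2 => ?_
  have hi : i < (u.ind.sort (· ≤ ·)).length := by simpa using h2
  have hmem : (u.ind.sort (· ≤ ·))[i] ∈ u.ind :=
    (Finset.mem_sort (· ≤ ·)).1 (List.getElem_mem hi)
  simp only [NCMon.scomp, List.getElem_map, List.getElem_range, NCMon.block]
  simp only [← rk_sort_getElem u.ind i hi]
  congr 1
  · congr 1
    refine Finset.filter_congr fun t ht => rk_eq_iff ?_ hmem
    have ht := Finset.mem_range.1 ht
    rw [List.getD_eq_getElem _ _ ht]
    exact Finset.mem_union_right _ (by simp)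
  · congr 1
    rw [eq_iff_iff, Finset.mem_image]
    constructor
    · rintro ⟨s, hs, h⟩
      rwa [← (rk_eq_iff (Finset.mem_union_left _ hs) hmem).1 h]
    · exact fun h => ⟨_, h, rfl⟩

lemma sort_filter_eq (A : Finset ℕ) (p : ℕ → Prop) [DecidablePred p] :
    (A.filter p).sort (· ≤ ·) = (A.sort (· ≤ ·)).filter p := by
  refine List.Perm.eq_of_pairwise (fun a b _ _ h h' => absurd (h.trans h') (lt_irrefl _))
    (sort_pairwise_lt _) ((sort_pairwise_lt A).filter _) ?_
  rw [List.perm_ext_iff_of_nodup (Finset.sort_nodup _ _) ((Finset.sort_nodup _ _).filter _)]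
  simp

lemma NCMon.scomp_eq_filter {u : NCMon} {A : Finset ℕ} (h : u.ind ⊆ A) :
    u.scomp = ((A.sort (· ≤ ·)).map u.block).filter (· ≠ ∅) := by
  have : u.ind = A.filter fun a => u.block a ≠ ∅ := by
    ext a
    rw [Finset.mem_filter, NCMon.block_ne_empty]
    exact ⟨fun h' => ⟨h h', h'⟩, fun h' => h'.2⟩
  rw [NCMon.scomp_eq, List.filter_map, this, sort_filter_eq]
  rfl

lemma NCMon.mem_unionNZ_scomp {u : NCMon} {x : ℕ} :
    x ∈ unionNZ u.scomp ↔ x ≠ 0 ∧ x ≤ u.w.length := by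
  rw [mem_unionNZ, NCMon.scomp_eq]
  refine and_congr_right fun hx => ?_
  simp only [List.mem_map, Finset.mem_sort]
  constructor
  · rintro ⟨_, ⟨a, -, rfl⟩, h⟩
    rcases NCMon.mem_block.1 h with ⟨t, ht, rfl⟩ | ⟨h, -⟩
    · exact (List.getElem?_eq_some_iff.1 ht).1
    · exact absurd h hx
  · intro h
    have hlt : x - 1 < u.w.length := by omega
    have hb : x ∈ u.block u.w[x - 1] :=
      NCMon.mem_block.2 (Or.inl ⟨x - 1, List.getElem?_eq_getElem hlt, by omega⟩)
    exact ⟨_, ⟨_, NCMon.block_ne_empty.1 (Finset.ne_empty_of_mem hb), rfl⟩, hb⟩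

lemma Coarse.length_word {I : List (Finset ℕ)} {u : NCMon} (h : Coarse I u.scomp) :
    u.w.length = (unionNZ I).card := by
  have h1 : unionNZ I = unionNZ u.scomp := by
    have : (blockUnion I).erase 0 = (blockUnion u.scomp).erase 0 := by rw [h.blockUnion_eq]
    exact this
  have h2 : unionNZ u.scomp = Finset.Icc 1 u.w.length := by
    ext x
    rw [NCMon.mem_unionNZ_scomp, Finset.mem_Icc, Nat.one_le_iff_ne_zero]
  rw [h1, h2, Nat.card_Icc, Nat.add_sub_cancel]

lemma mem_shiftB {n x : ℕ} {B : Finset ℕ} :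
    x ∈ shiftB n B ↔ (x = 0 ∧ 0 ∈ B) ∨ ∃ y ∈ B, y ≠ 0 ∧ y + n = x := by
  simp only [shiftB, Finset.mem_image]
  constructor
  · rintro ⟨y, hy, h⟩
    by_cases h0 : y = 0
    · subst h0; exact Or.inl ⟨by simpa using h.symm, hy⟩
    · rw [if_neg h0] at h; exact Or.inr ⟨y, hy, h0, h⟩
  · rintro (⟨rfl, h⟩ | ⟨y, hy, h0, rfl⟩)
    · exact ⟨0, h, by simp⟩
    · exact ⟨y, hy, by simp [h0]⟩

lemma zero_mem_shiftB {n : ℕ} {B : Finset ℕ} : 0 ∈ shiftB n B ↔ 0 ∈ B := by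
  rw [mem_shiftB]
  constructor
  · rintro (h | ⟨y, -, h, h'⟩)
    · exact h.2
    · omega
  · exact fun h => Or.inl ⟨rfl, h⟩

lemma shiftB_injective (n : ℕ) : Function.Injective (shiftB n) := by
  refine Finset.image_injective fun a b h => ?_
  split_ifs at h <;> omega

lemma shiftB_eq_empty {n : ℕ} {B : Finset ℕ} : shiftB n B = ∅ ↔ B = ∅ := by
  simp [shiftB]

lemma blockUnion_shiftC (n : ℕ) (g : List (Finset ℕ)) :
    blockUnion (shiftC n g) = shiftB n (blockUnion g) := by
  induction g with
  | nil => rfl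
  | cons B g ih =>
    have : shiftC n (B :: g) = shiftB n B :: shiftC n g := rfl
    rw [this, blockUnion_cons, blockUnion_cons, ih, shiftB, shiftB, shiftB, Finset.image_union]

lemma isIncr_shiftC {n : ℕ} {g : List (Finset ℕ)} : IsIncr (shiftC n g) ↔ IsIncr g := by
  unfold IsIncr shiftC
  have h0 : (∀ B ∈ g.map (shiftB n), 0 ∉ B) ↔ ∀ B ∈ g, 0 ∉ B := by simp [zero_mem_shiftB]
  rw [h0, List.pairwise_map]
  refine and_congr_left fun h0 => ?_
  refine List.Pairwise.iff_of_mem fun {B C} hB hC => ?_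
  have hB0 := h0 B hB
  have hC0 := h0 C hC
  constructor
  · intro h b hb c hc
    have := h (b + n) (mem_shiftB.2 (Or.inr ⟨b, hb, fun h => hB0 (h ▸ hb), rfl⟩))
      (c + n) (mem_shiftB.2 (Or.inr ⟨c, hc, fun h => hC0 (h ▸ hc), rfl⟩))
    omega
  · intro h b hb c hc
    rcases mem_shiftB.1 hb with ⟨-, h'⟩ | ⟨b', hb', -, rfl⟩
    · exact absurd h' hB0
    rcases mem_shiftB.1 hc with ⟨-, h'⟩ | ⟨c', hc', -, rfl⟩
    · exact absurd h' hC0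
    have := h b' hb' c' hc'
    omega

lemma isGroup_shiftC {n : ℕ} {g : List (Finset ℕ)} : IsGroup (shiftC n g) ↔ IsGroup g := by
  unfold IsGroup
  rw [isIncr_shiftC]
  refine or_congr_right ⟨?_, ?_⟩
  · rintro ⟨B, hg, hB⟩
    obtain ⟨C, rfl, rfl⟩ := List.map_eq_singleton_iff.1 hg
    exact ⟨C, rfl, zero_mem_shiftB.1 hB⟩
  · rintro ⟨B, rfl, hB⟩
    exact ⟨shiftB n B, rfl, zero_mem_shiftB.2 hB⟩

lemma coarse_shiftC {n : ℕ} {J P : List (Finset ℕ)} :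
    Coarse (shiftC n J) (shiftC n P) ↔ Coarse J P := by
  constructor
  · induction P generalizing J with
    | nil =>
      intro h
      obtain rfl := List.map_eq_nil_iff.1 (coarse_nil_right h)
      exact .nil
    | cons B P ih =>
      intro h
      obtain ⟨g', Q, hJ, hB, hg, hG, h'⟩ := coarse_cons_right h
      obtain ⟨g, J', rfl, rfl, rfl⟩ := List.map_eq_append_iff.1 hJ
      obtain rfl := shiftB_injective n (hB.trans (blockUnion_shiftC n g))
      exact .cons _ _ _ (by simpa using hg) (isGroup_shiftC.1 hG) (ih h')
  · intro h
    induction h with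
    | nil => exact .nil
    | cons g I P hg hG _ ih =>
      have h1 : shiftC n (g ++ I) = shiftC n g ++ shiftC n I := List.map_append
      have h2 : shiftC n (blockUnion g :: P) = blockUnion (shiftC n g) :: shiftC n P := by
        rw [blockUnion_shiftC]; rfl
      rw [h1, h2]
      exact .cons _ _ _ (by simpa [shiftC] using hg) (isGroup_shiftC.2 hG) ih

/-- Split a block into its part with entries at most `n` and its part with entries larger
than `n`, the entry `0` going to the first part if and only if `c` holds. -/
def splitBlock (n : ℕ) (c : Bool) (X : Finset ℕ) : Finset ℕ × Finset ℕ :=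
  (X.filter fun x => x ≤ n ∧ (x = 0 → c), X.filter fun x => n < x ∨ (x = 0 ∧ !c))

lemma splitBlock_union (n : ℕ) (c : Bool) (X : Finset ℕ) :
    (splitBlock n c X).1 ∪ (splitBlock n c X).2 = X := by
  ext x
  simp only [splitBlock, Finset.mem_union, Finset.mem_filter]
  by_cases hx : x = 0
  · cases c <;> simp [hx]
  · simp only [hx, false_imp_iff, and_true, false_and, or_false, ← and_or_left]
    exact ⟨fun h => h.1, fun h => ⟨h, le_or_gt x n⟩⟩

lemma zero_mem_splitBlock_snd (n : ℕ) (c : Bool) (X : Finset ℕ) :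
    0 ∈ (splitBlock n c X).2 ↔ 0 ∈ X ∧ c = false := by
  simp [splitBlock]

lemma zero_mem_splitBlock_fst (n : ℕ) (c : Bool) (X : Finset ℕ) :
    0 ∈ (splitBlock n c X).1 ↔ 0 ∈ X ∧ c = true := by
  simp [splitBlock]

lemma NCMon.block_take (n : ℕ) {S T : Finset ℕ} (w : List ℕ) (hT : T ⊆ S) (a : ℕ) :
    NCMon.block ⟨T, w.take n⟩ a = (splitBlock n (decide (a ∈ T)) (NCMon.block ⟨S, w⟩ a)).1 := by
  ext x
  simp only [splitBlock, Finset.mem_filter, NCMon.mem_block, List.getElem?_take]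
  constructor
  · rintro (⟨t, ht, rfl⟩ | ⟨rfl, h⟩)
    · split_ifs at ht with h
      exact ⟨Or.inl ⟨t, ht, rfl⟩, h, by simp⟩
    · exact ⟨Or.inr ⟨rfl, hT h⟩, by simp, by simpa using h⟩
  · rintro ⟨⟨t, ht, rfl⟩ | ⟨rfl, h⟩, h1, h2⟩
    · exact Or.inl ⟨t, by rw [if_pos (by omega)]; exact ht, rfl⟩
    · exact Or.inr ⟨rfl, by simpa using h2⟩

lemma NCMon.block_drop (n : ℕ) {S T : Finset ℕ} (w : List ℕ) (a : ℕ) :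
    shiftB n (NCMon.block ⟨S \ T, w.drop n⟩ a) =
      (splitBlock n (decide (a ∈ T)) (NCMon.block ⟨S, w⟩ a)).2 := by
  ext x
  simp only [splitBlock, Finset.mem_filter, mem_shiftB, NCMon.mem_block, List.getElem?_drop]
  constructor
  · rintro (⟨rfl, ⟨t, -, ht⟩ | ⟨-, h⟩⟩ | ⟨y, ⟨t, ht, rfl⟩ | ⟨rfl, -⟩, h0, rfl⟩)
    · omega
    · rw [Finset.mem_sdiff] at h
      exact ⟨Or.inr ⟨rfl, h.1⟩, by simp [h.2]⟩
    · exact ⟨Or.inl ⟨n + t, ht, by omega⟩, Or.inl (by omega)⟩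
    · exact absurd rfl h0
  · rintro ⟨⟨t, ht, rfl⟩ | ⟨rfl, h⟩, h1⟩
    · have hn : n ≤ t := by
        rcases h1 with h1 | ⟨h1, -⟩ <;> omega
      exact Or.inr ⟨t - n + 1, Or.inl ⟨t - n, by rwa [Nat.add_sub_cancel' hn], rfl⟩, by omega,
        by omega⟩
    · refine Or.inl ⟨rfl, Or.inr ⟨trivial, Finset.mem_sdiff.2 ⟨h, ?_⟩⟩⟩
      simpa using h1

/-- The pairs of blocks obtained from the blocks of a monomial by splitting off the letters
after position `n` and the θ-indices outside `T`. -/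
def NCMon.splitBlocks (n : ℕ) (m : NCMon) (T : Finset ℕ) : List (Finset ℕ × Finset ℕ) :=
  (m.ind.sort (· ≤ ·)).map fun a => splitBlock n (decide (a ∈ T)) (m.block a)

lemma NCMon.splitBlocks_union (n : ℕ) (m : NCMon) (T : Finset ℕ) :
    (m.splitBlocks n T).map (fun p => p.1 ∪ p.2) = m.scomp := by
  rw [NCMon.splitBlocks, NCMon.scomp_eq, List.map_map]
  refine List.map_congr_left fun a _ => splitBlock_union _ _ _

lemma NCMon.splitBlocks_fst (n : ℕ) (m : NCMon) {T : Finset ℕ} (hT : T ⊆ m.S) :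
    ((m.splitBlocks n T).map Prod.fst).filter (· ≠ ∅) = NCMon.scomp ⟨T, m.w.take n⟩ := by
  have hsub : NCMon.ind ⟨T, m.w.take n⟩ ⊆ m.ind :=
    Finset.union_subset_union hT fun x hx => by
      simp only [List.mem_toFinset] at hx ⊢
      exact List.mem_of_mem_take hx
  rw [NCMon.scomp_eq_filter hsub, NCMon.splitBlocks, List.map_map]
  congr 1
  exact List.map_congr_left fun a _ => (NCMon.block_take n m.w hT a).symm

lemma NCMon.splitBlocks_snd (n : ℕ) (m : NCMon) (T : Finset ℕ) :
    ((m.splitBlocks n T).map Prod.snd).filter (· ≠ ∅) =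
      shiftC n (NCMon.scomp ⟨m.S \ T, m.w.drop n⟩) := by
  have hsub : NCMon.ind ⟨m.S \ T, m.w.drop n⟩ ⊆ m.ind :=
    Finset.union_subset_union Finset.sdiff_subset fun x hx => by
      simp only [List.mem_toFinset] at hx ⊢
      exact List.mem_of_mem_drop hx
  have hb : ((m.splitBlocks n T).map Prod.snd) =
      ((m.ind.sort (· ≤ ·)).map (NCMon.block ⟨m.S \ T, m.w.drop n⟩)).map (shiftB n) := by
    rw [NCMon.splitBlocks, List.map_map, List.map_map]
    exact List.map_congr_left fun a _ => (NCMon.block_drop n m.w a).symm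
  rw [NCMon.scomp_eq_filter hsub, hb, List.filter_map, shiftC]
  congr 2
  funext B
  simp [shiftB_eq_empty]

lemma NCMon.filter_splitBlocks (n : ℕ) (m : NCMon) (T : Finset ℕ) :
    (((m.splitBlocks n T).filter fun p => 0 ∈ p.1 ∪ p.2).map fun p => decide (0 ∈ p.2)) =
      (m.S.sort (· ≤ ·)).map fun a => decide (a ∉ T) := by
  have hS : m.S = m.ind.filter (· ∈ m.S) := by
    ext a
    simp only [Finset.mem_filter, NCMon.ind, Finset.mem_union]
    tauto
  have hsort : m.S.sort (· ≤ ·) = (m.ind.sort (· ≤ ·)).filter (· ∈ m.S) := by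
    rw [← sort_filter_eq, ← hS]
  rw [hsort, NCMon.splitBlocks, List.filter_map, List.map_map]
  have h1 : ((fun p : Finset ℕ × Finset ℕ => decide (0 ∈ p.1 ∪ p.2)) ∘ fun a =>
      splitBlock n (decide (a ∈ T)) (m.block a)) = fun a => decide (a ∈ m.S) := by
    funext a
    simp only [Function.comp_apply, splitBlock_union, NCMon.zero_mem_block]
  rw [h1]
  refine List.map_congr_left fun a ha => ?_
  have ha' : a ∈ m.S := by simpa using (List.mem_filter.1 ha).2
  simp [zero_mem_splitBlock_snd, NCMon.zero_mem_block, ha']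

lemma NCMon.splitBlocks_valid (n : ℕ) (m : NCMon) (T : Finset ℕ) :
    ∀ p ∈ m.splitBlocks n T, p.1 ∪ p.2 ≠ ∅ ∧ ¬ (0 ∈ p.1 ∧ 0 ∈ p.2) := by
  intro p hp
  obtain ⟨a, ha, rfl⟩ := List.mem_map.1 hp
  rw [splitBlock_union, NCMon.block_ne_empty, zero_mem_splitBlock_fst, zero_mem_splitBlock_snd]
  refine ⟨(Finset.mem_sort (· ≤ ·)).1 ha, ?_⟩
  rintro ⟨⟨-, h⟩, -, h'⟩
  rw [h] at h'
  cases h'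

lemma Assembled.separated {n : ℕ} {D : List (Finset ℕ × Finset ℕ)} {L : List (Bool × Finset ℕ)}
    {K : List (Finset ℕ)} (h : Assembled D L K) (hs : Separated n L) :
    ∀ p ∈ D, (∀ x ∈ p.1, x ≤ n) ∧ (∀ x ∈ p.2, x = 0 ∨ n < x) ∧ ¬ (0 ∈ p.1 ∧ 0 ∈ p.2) := by
  induction h with
  | nil => simp
  | cons g h D L K hg hh _ h0 _ ih =>
    intro p hp
    rcases List.mem_cons.1 hp with rfl | hp
    · refine ⟨fun x hx => ?_, fun x hx => ?_, h0⟩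
      · obtain ⟨B, hB, hx⟩ := mem_blockUnion.1 hx
        exact hs.1 B (by rw [tagged_false_glue]; simp [hB]) x hx
      · obtain ⟨B, hB, hx⟩ := mem_blockUnion.1 hx
        exact hs.2 B (by rw [tagged_true_glue]; simp [hB]) x hx
    · exact ih hs.right.right p hp

lemma eq_splitBlock {n : ℕ} {p : Finset ℕ × Finset ℕ} (h1 : ∀ x ∈ p.1, x ≤ n)
    (h2 : ∀ x ∈ p.2, x = 0 ∨ n < x) (h0 : ¬ (0 ∈ p.1 ∧ 0 ∈ p.2)) :
    p = splitBlock n (decide (0 ∈ p.1)) (p.1 ∪ p.2) := by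
  refine Prod.ext ?_ ?_
  · ext x
    simp only [splitBlock, Finset.mem_filter, Finset.mem_union, decide_eq_true_eq]
    constructor
    · exact fun h => ⟨Or.inl h, h1 x h, fun hx => hx ▸ h⟩
    · rintro ⟨h | h, h3, h4⟩
      · exact h
      · rcases h2 x h with rfl | h5
        · exact h4 rfl
        · omega
  · ext x
    simp only [splitBlock, Finset.mem_filter, Finset.mem_union, Bool.not_eq_true',
      decide_eq_false_iff_not]
    constructor
    · refine fun h => ⟨Or.inr h, ?_⟩
      rcases h2 x h with rfl | h3
      · exact Or.inr ⟨rfl, fun h' => h0 ⟨h', h⟩⟩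
      · exact Or.inl h3
    · rintro ⟨h | h, h3⟩
      · rcases h3 with h3 | ⟨rfl, h3⟩
        · have := h1 x h; omega
        · exact absurd h h3
      · exact h

lemma exists_eq_map_splitBlock {n : ℕ} (P : ℕ → Finset ℕ) {l : List ℕ} (hl : l.Nodup) :
    ∀ {D : List (Finset ℕ × Finset ℕ)}, D.map (fun p => p.1 ∪ p.2) = l.map P →
      (∀ p ∈ D, (∀ x ∈ p.1, x ≤ n) ∧ (∀ x ∈ p.2, x = 0 ∨ n < x) ∧ ¬ (0 ∈ p.1 ∧ 0 ∈ p.2)) →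
      ∃ T : Finset ℕ, (∀ a ∈ T, a ∈ l ∧ 0 ∈ P a) ∧
        D = l.map fun a => splitBlock n (decide (a ∈ T)) (P a) := by
  induction l with
  | nil =>
    intro D hD _
    exact ⟨∅, by simp, List.map_eq_nil_iff.1 hD⟩
  | cons a l ih =>
    intro D hD hw
    obtain ⟨hal, hl⟩ := List.nodup_cons.1 hl
    obtain ⟨p, D, rfl, hp, hD⟩ := List.map_eq_cons_iff.1 hD
    obtain ⟨T, hT, rfl⟩ := ih hl hD fun q hq => hw q (List.mem_cons_of_mem _ hq)
    have haT : a ∉ T := fun h => hal (hT a h).1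
    have hpw := hw p List.mem_cons_self
    have hps := eq_splitBlock hpw.1 hpw.2.1 hpw.2.2
    rw [hp] at hps
    refine ⟨if 0 ∈ p.1 then insert a T else T, ?_, ?_⟩
    · intro b hb
      split_ifs at hb with h
      · rcases Finset.mem_insert.1 hb with rfl | hb
        · exact ⟨List.mem_cons_self, by rw [← hp]; exact Finset.mem_union_left _ h⟩
        · exact ⟨List.mem_cons_of_mem _ (hT b hb).1, (hT b hb).2⟩
      · exact ⟨List.mem_cons_of_mem _ (hT b hb).1, (hT b hb).2⟩
    · rw [List.map_cons]
      congr 1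
      · rw [hps]
        congr 1
        rw [← hps]
        split_ifs with h <;> simp [h, haT]
      · refine List.map_congr_left fun b hb => ?_
        have hba : b ≠ a := fun h => hal (h ▸ hb)
        congr 1
        split_ifs <;> simp [hba]

lemma Assembled.exists_splitBlocks {n : ℕ} {m : NCMon} {D : List (Finset ℕ × Finset ℕ)}
    {L : List (Bool × Finset ℕ)} {K : List (Finset ℕ)} (h : Assembled D L K)
    (hs : Separated n L) (hD : D.map (fun p => p.1 ∪ p.2) = m.scomp) :
    ∃ T ⊆ m.S, D = m.splitBlocks n T := by
  rw [NCMon.scomp_eq] at hD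
  obtain ⟨T, hT, rfl⟩ := exists_eq_map_splitBlock m.block (Finset.sort_nodup _ _) hD
    (h.separated hs)
  exact ⟨T, fun a ha => NCMon.zero_mem_block.1 (hT a ha).2, rfl⟩

lemma Assembled.eps_eq {n : ℕ} {m : NCMon} {T : Finset ℕ} (hT : T ⊆ m.S)
    {L : List (Bool × Finset ℕ)} {K : List (Finset ℕ)} (h : Assembled (m.splitBlocks n T) L K) :
    eps L = invST T (m.S \ T) := by
  rw [eps_eq_boolInv, h.fermionTags, NCMon.filter_splitBlocks,
    ← invST_toFinset (· ∈ T) (sort_pairwise_lt m.S), Finset.sort_toFinset,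
    Finset.filter_mem_eq_inter, Finset.inter_eq_right.2 hT, Finset.filter_notMem_eq_sdiff]

lemma Assembled.eq_of_splitBlocks {n : ℕ} {m : NCMon} {T T' : Finset ℕ} (hT : T ⊆ m.S)
    (hT' : T' ⊆ m.S) {L : List (Bool × Finset ℕ)} {K : List (Finset ℕ)}
    (h : Assembled (m.splitBlocks n T) L K) (h' : Assembled (m.splitBlocks n T') L K) :
    T = T' := by
  have he := h.fermionTags.symm.trans h'.fermionTags
  rw [NCMon.filter_splitBlocks, NCMon.filter_splitBlocks, List.map_inj_left] at he
  ext a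
  by_cases ha : a ∈ m.S
  · have := he a ((Finset.mem_sort _).2 ha)
    rw [decide_eq_decide] at this
    exact not_iff_not.1 this
  · exact ⟨fun h => absurd (hT h) ha, fun h => absurd (hT' h) ha⟩

lemma finite_bounded_lists {α : Type*} {s : Set α} (hs : s.Finite) (N : ℕ) :
    {l : List α | l.length ≤ N ∧ ∀ x ∈ l, x ∈ s}.Finite := by
  have : Finite s := hs
  refine ((List.finite_length_le s N).image (List.map Subtype.val)).subset ?_
  rintro l ⟨h1, h2⟩
  exact ⟨l.attach.map fun x => ⟨x.1, h2 _ x.2⟩, by simpa using h1, by simp [Function.comp_def]⟩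

lemma finite_block_lists (U : Finset ℕ) (N : ℕ) :
    {K : List (Finset ℕ) | K.length ≤ N ∧ blockUnion K ⊆ U}.Finite := by
  refine (finite_bounded_lists (Finset.finite_toSet U.powerset) N).subset ?_
  rintro K ⟨h1, h2⟩
  refine ⟨h1, fun B hB => ?_⟩
  rw [Finset.mem_coe, Finset.mem_powerset]
  exact fun x hx => h2 (mem_blockUnion.2 ⟨B, hB, hx⟩)

lemma SMerge.length_le {L : List (Bool × Finset ℕ)} {K : List (Finset ℕ)} (h : SMerge L K) :
    K.length ≤ L.length := by
  induction h <;> simp <;> omega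

lemma SMerge.blockUnion_eq {L : List (Bool × Finset ℕ)} {K : List (Finset ℕ)}
    (h : SMerge L K) : blockUnion K = blockUnion (L.map Prod.snd) := by
  have hid : ∀ b : Bool, (Prod.snd ∘ fun C : Finset ℕ => (b, C)) = id := fun _ => rfl
  induction h with
  | nil => rfl
  | single b B L K _ ih => simp [ih]
  | mergeI B bs L K _ _ _ _ ih =>
    simp [ih, foldr_union_eq, blockUnion_append, hid, Finset.union_assoc]
  | mergeJ bs B L K _ _ _ _ ih =>
    simp [ih, foldr_union_eq, blockUnion_append, hid, Finset.union_assoc,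
      Finset.union_left_comm]

lemma tagged_length (L : List (Bool × Finset ℕ)) :
    (tagged false L).length + (tagged true L).length = L.length := by
  induction L with
  | nil => rfl
  | cons p L ih =>
    obtain ⟨b, B⟩ := p
    unfold tagged at ih ⊢
    cases b <;> simp at ih ⊢ <;> omega

/-- The pairs of a shuffle and a super-shuffle obtained from it. -/
def superShuffles (I J : List (Finset ℕ)) : Set (List (Bool × Finset ℕ) × List (Finset ℕ)) :=
  {p | IsShuffle I J p.1 ∧ SMerge p.1 p.2}

lemma finite_superShuffles (I J : List (Finset ℕ)) : (superShuffles I J).Finite := by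
  have hs : {p : Bool × Finset ℕ | p.2 ∈ I ++ J}.Finite := by
    refine ((Set.finite_univ (α := Bool)).prod (List.finite_toSet (I ++ J))).subset ?_
    exact fun p hp => ⟨Set.mem_univ _, hp⟩
  refine ((finite_bounded_lists hs (I.length + J.length)).prod
    (finite_block_lists (blockUnion (I ++ J)) (I.length + J.length))).subset ?_
  rintro ⟨L, K⟩ ⟨hL, hK⟩
  dsimp only at hL hK
  obtain ⟨rfl, rfl⟩ := isShuffle_iff.1 hL
  rw [tagged_length]
  have hmem : ∀ p ∈ L, p.2 ∈ tagged false L ++ tagged true L := by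
    rintro ⟨b, B⟩ hp
    rw [List.mem_append, mem_tagged, mem_tagged]
    cases b
    · exact Or.inl hp
    · exact Or.inr hp
  refine ⟨⟨le_rfl, hmem⟩, hK.length_le, ?_⟩
  rw [hK.blockUnion_eq]
  intro x hx
  obtain ⟨B, hB, hx⟩ := mem_blockUnion.1 hx
  obtain ⟨p, hp, rfl⟩ := List.mem_map.1 hB
  exact mem_blockUnion.2 ⟨_, hmem p hp, hx⟩

lemma finite_ssle (I : List (Finset ℕ)) : {P | SSle I P}.Finite := by
  refine (finite_block_lists (blockUnion I) I.length).subset fun P hP => ?_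
  have h := ssle_iff_coarse.1 hP
  exact ⟨h.length_le, h.blockUnion_eq.ge⟩

open Classical in
lemma Qfn_apply (I : List (Finset ℕ)) (u : NCMon) :
    Qfn I u = if Coarse I u.scomp then 1 else 0 := by
  have h : Qfn I = ∑ P ∈ (finite_ssle I).toFinset, Mfn P :=
    finsum_mem_eq_finite_toFinset_sum Mfn (finite_ssle I)
  rw [h, Finset.sum_apply]
  simp [Mfn, ssle_iff_coarse]

lemma superShuffle_sum_eq {M : Type*} [AddCommMonoid M] (I J : List (Finset ℕ))
    (f : List (Bool × Finset ℕ) → List (Finset ℕ) → M) :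
    ∑ᶠ (L : List (Bool × Finset ℕ)) (K : List (Finset ℕ)) (_ : IsShuffle I J L)
      (_ : SMerge L K), f L K = ∑ p ∈ (finite_superShuffles I J).toFinset, f p.1 p.2 := by
  classical
  have hand : ∀ L K, ∑ᶠ (_ : IsShuffle I J L) (_ : SMerge L K), f L K =
      if (L, K) ∈ superShuffles I J then f L K else 0 := by
    intro L K
    rw [finsum_eq_if, finsum_eq_if, ← ite_and]
    exact if_congr Iff.rfl rfl rfl
  simp only [hand]
  have hsupp : (Function.support fun p : List (Bool × Finset ℕ) × List (Finset ℕ) =>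
      if p ∈ superShuffles I J then f p.1 p.2 else 0) ⊆ (finite_superShuffles I J).toFinset := by
    intro p hp
    by_contra h
    exact hp (if_neg (by simpa using h))
  rw [← finsum_curry (fun p : List (Bool × Finset ℕ) × List (Finset ℕ) =>
      if p ∈ superShuffles I J then f p.1 p.2 else 0)
      ((finite_superShuffles I J).subset (by simpa using hsupp)),
    finsum_eq_sum_of_support_subset _ hsupp]
  exact Finset.sum_congr rfl fun p hp => if_pos (by simpa using hp)

open Classical in
lemma mulF_Qfn_apply (I J : List (Finset ℕ)) (m : NCMon) :
    mulF (Qfn I) (Qfn J) m =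
      ∑ T ∈ m.S.powerset.filter (fun T =>
        Coarse I (NCMon.scomp ⟨T, m.w.take (unionNZ I).card⟩) ∧
          Coarse J (NCMon.scomp ⟨m.S \ T, m.w.drop (unionNZ I).card⟩)),
        (-1 : ℚ) ^ invST T (m.S \ T) := by
  set n := (unionNZ I).card with hn
  have hlen : ∀ {k T}, Coarse I (NCMon.scomp ⟨T, m.w.take k⟩) → min k m.w.length = n := by
    intro k T h
    simpa using h.length_word
  unfold mulF
  rw [Finset.sum_eq_single n]
  · rw [Finset.sum_filter]
    refine Finset.sum_congr rfl fun T _ => ?_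
    rw [Qfn_apply, Qfn_apply, ite_and]
    split_ifs <;> simp
  · intro k hk hkn
    refine Finset.sum_eq_zero fun T _ => ?_
    rw [Qfn_apply, if_neg, mul_zero, zero_mul]
    intro h
    have := hlen h
    have := Finset.mem_range.1 hk
    omega
  · intro hk
    refine Finset.sum_eq_zero fun T _ => ?_
    rw [Qfn_apply, if_neg, mul_zero, zero_mul]
    intro h
    have := hlen h
    rw [Finset.mem_range] at hk
    omega

lemma IsSSC.separated {I : List (Finset ℕ)} (hI : IsSSC I) (J : List (Finset ℕ))
    {L : List (Bool × Finset ℕ)} (h1 : tagged false L = I)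
    (h2 : tagged true L = shiftC (unionNZ I).card J) : Separated (unionNZ I).card L := by
  refine ⟨fun B hB x hx => ?_, fun B hB x hx => ?_⟩
  · by_cases h0 : x = 0
    · omega
    · have : x ∈ unionNZ I := mem_unionNZ.2 ⟨h0, B, h1 ▸ hB, hx⟩
      rw [hI.2.2, Finset.mem_Icc] at this
      exact this.2
  · rw [h2] at hB
    obtain ⟨C, -, rfl⟩ := List.mem_map.1 hB
    rcases mem_shiftB.1 hx with ⟨h, -⟩ | ⟨y, -, h0, rfl⟩
    · exact Or.inl h
    · right; omega

lemma IsSSC.nonempty_of_tagged {I J : List (Finset ℕ)} (hI : IsSSC I) (hJ : IsSSC J) {n : ℕ}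
    {L : List (Bool × Finset ℕ)} (h1 : tagged false L = I) (h2 : tagged true L = shiftC n J) :
    ∀ b, ∀ B ∈ tagged b L, B.Nonempty := by
  rintro (_ | _) B hB
  · exact hI.1 B (h1 ▸ hB)
  · rw [h2] at hB
    obtain ⟨C, hC, rfl⟩ := List.mem_map.1 hB
    exact (hJ.1 C hC).image _

/-- **Theorem.** For set supercompositions `I` and `J`,
`Q_I · Q_J = ∑_{K ∈ SSh(I,J)} sgn(K) Q_K`, the sum running over all `(I,J)`-super-shuffles
`K` (pairs of an underlying tagged shuffle `L` of `I` and `J[n]` and a resulting merged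
sequence `K`), with sign `(-1)^{ε(L)}`. -/
theorem mul_Q_basis (I J : List (Finset ℕ)) (hI : IsSSC I) (hJ : IsSSC J) :
    mulF (Qfn I) (Qfn J) =
      ∑ᶠ (L : List (Bool × Finset ℕ)) (K : List (Finset ℕ))
        (_ : IsShuffle I (shiftC (unionNZ I).card J) L) (_ : SMerge L K),
        ((-1 : ℚ) ^ eps L) • Qfn K := by
  classical
  rw [superShuffle_sum_eq]
  funext m
  rw [mulF_Qfn_apply, Finset.sum_apply]
  simp only [Pi.smul_apply, Qfn_apply, smul_eq_mul, mul_ite, mul_one, mul_zero]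
  rw [← Finset.sum_filter]
  have hex : ∀ T ∈ m.S.powerset.filter (fun T =>
      Coarse I (NCMon.scomp ⟨T, m.w.take (unionNZ I).card⟩) ∧
        Coarse J (NCMon.scomp ⟨m.S \ T, m.w.drop (unionNZ I).card⟩)),
      ∃ p : List (Bool × Finset ℕ) × List (Finset ℕ),
        Assembled (m.splitBlocks (unionNZ I).card T) p.1 p.2 ∧ tagged false p.1 = I ∧
          tagged true p.1 = shiftC (unionNZ I).card J := by
    intro T hT
    rw [Finset.mem_filter, Finset.mem_powerset] at hT
    obtain ⟨hT, h1, h2⟩ := hT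
    rw [← NCMon.splitBlocks_fst _ _ hT] at h1
    rw [← coarse_shiftC, ← NCMon.splitBlocks_snd] at h2
    obtain ⟨L, K, h⟩ := exists_assembled (NCMon.splitBlocks_valid _ _ _) h1 h2
    exact ⟨(L, K), h⟩
  choose i hi using hex
  refine Finset.sum_bij i ?_ ?_ ?_ ?_
  · intro T hT
    obtain ⟨hA, h1, h2⟩ := hi T hT
    rw [Finset.mem_filter, Set.Finite.mem_toFinset]
    refine ⟨⟨isShuffle_iff.2 ⟨h1, h2⟩, hA.smerge⟩, ?_⟩
    rw [← NCMon.splitBlocks_union]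
    exact hA.coarse (hI.separated J h1 h2)
  · intro T hT T' hT' h
    have hA := (hi T hT).1
    have hA' := (hi T' hT').1
    rw [← h] at hA'
    rw [Finset.mem_filter, Finset.mem_powerset] at hT hT'
    exact hA.eq_of_splitBlocks hT.1 hT'.1 hA'
  · rintro ⟨L, K⟩ hp
    rw [Finset.mem_filter, Set.Finite.mem_toFinset] at hp
    obtain ⟨⟨hL, hK⟩, hc⟩ := hp
    dsimp only at hL hK hc
    obtain ⟨h1, h2⟩ := isShuffle_iff.1 hL
    have hs := hI.separated J h1 h2
    have hne := hI.nonempty_of_tagged hJ h1 h2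
    obtain ⟨D, hD, hm⟩ := hK.exists_assembled hc hs hne
    obtain ⟨T, hT, rfl⟩ := hD.exists_splitBlocks hs hm
    have hf := hD.coarse_fst (hne false)
    have hg := hD.coarse_snd (hne true)
    rw [NCMon.splitBlocks_fst _ _ hT, h1] at hf
    rw [NCMon.splitBlocks_snd, h2, coarse_shiftC] at hg
    refine ⟨T, Finset.mem_filter.2 ⟨Finset.mem_powerset.2 hT, hf, hg⟩, ?_⟩
    obtain ⟨hA, h1', h2'⟩ := hi T (Finset.mem_filter.2 ⟨Finset.mem_powerset.2 hT, hf, hg⟩)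
    obtain ⟨e1, e2⟩ := hD.unique hA hne fun b => by
      cases b
      · rw [h1, h1']
      · rw [h2, h2']
    exact Prod.ext e1.symm e2.symm
  · intro T hT
    rw [(hi T hT).1.eps_eq (Finset.mem_powerset.1 (Finset.mem_filter.1 hT).1)]
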